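/- arXiv:1404.0652 — 7 statements merged into one kernel-verified Lean document; each statement's English description precedes it below -/
import Mathlib

section
/- Let p ∈ (0,2], let d ≥ 1 be a real number, let B₀ ≥ B_∞ > 0 and A₊, A₋ > 0, and let V_∞ ∈ ℝ. Then there exist constants c > 0, C > 0 and γ₀ ∈ (0,1) (depending only on p, d, B₀, B_∞, A₊, A₋) such that for every γ ∈ (0,γ₀), setting t₀ = |ln γ|, every continuous function W : [0,∞) → ℝ satisfying V_∞ + γ e^{−B₀ t} + γ^{p+1} A₊ t^{−(p+d)} χ{t ≥ t₀+1} ≤ W(t) ≤ V_∞ + γ e^{−B_∞ t} + γ^{p+1} A₋ (1+t)^{−(p+d)} for all t ≥ 0 obeys the two bounds: ⟨W⟩_t − W(t) ≥ c γ / t for all t ≥ t₀, and ⟨W⟩_t − W(t) ≤ C (γ + γ^{p+1} A₋) / (1+t) for all t > 0. -/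
open MeasureTheory Real Set

open Filter Topology in
theorem aux_exp_int (b t : ℝ) (hb : 0 < b) :
    (∫ τ in (0:ℝ)..t, Real.exp (-b * τ)) = (1 - Real.exp (-b * t)) / b := by
  have h : ∀ x ∈ Set.uIcc 0 t,
      HasDerivAt (fun x : ℝ => -Real.exp (-b * x) / b) (Real.exp (-b * x)) x := by
    intro x _
    have h1 : HasDerivAt (fun x : ℝ => -b * x) (-b) x := by
      simpa using (hasDerivAt_id x).const_mul (-b)
    have h2 := (h1.exp.neg).div_const b
    have e : -(Real.exp (-b * x) * -b) / b = Real.exp (-b * x) := by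
      field_simp
    rw [e] at h2
    exact h2
  rw [intervalIntegral.integral_eq_sub_of_hasDerivAt h
    (Continuous.intervalIntegrable (by fun_prop) _ _)]
  simp
  ring

theorem aux_cont_rpow (q t : ℝ) (ht : 0 ≤ t) :
    IntervalIntegrable (fun τ : ℝ => (1 + τ) ^ q) volume 0 t := by
  apply ContinuousOn.intervalIntegrable
  intro x hx
  rw [Set.uIcc_of_le ht] at hx
  apply ContinuousAt.continuousWithinAt
  apply ContinuousAt.rpow_const (by fun_prop)
  left
  have := hx.1
  positivity

theorem aux_rpow_int (p t : ℝ) (hp : 0 < p) (ht : 0 ≤ t) :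
    (∫ τ in (0:ℝ)..t, (1 + τ) ^ (-(p + 1))) ≤ 1 / p := by
  have h : ∀ x ∈ Set.uIcc 0 t,
      HasDerivAt (fun x : ℝ => -(1 + x) ^ (-p) / p) ((1 + x) ^ (-(p + 1))) x := by
    intro x hx
    rw [Set.uIcc_of_le ht] at hx
    have hx0 := hx.1
    have h1 : HasDerivAt (fun x : ℝ => 1 + x) 1 x := by
      simpa using (hasDerivAt_id x).const_add 1
    have h2 := ((h1.rpow_const (p := -p) (Or.inl (by positivity))).neg).div_const p
    have e : -(1 * -p * (1 + x) ^ (-p - 1)) / p = (1 + x) ^ (-(p + 1)) := by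
      rw [show -p - 1 = -(p + 1) by ring]
      field_simp
    rw [e] at h2
    exact h2
  rw [intervalIntegral.integral_eq_sub_of_hasDerivAt h (aux_cont_rpow _ _ ht)]
  have : 0 ≤ (1 + t) ^ (-p) / p := by positivity
  have e : -(1 + t) ^ (-p) / p - -(1 + 0 : ℝ) ^ (-p) / p = 1 / p - (1 + t) ^ (-p) / p := by
    rw [add_zero, Real.one_rpow]
    ring
  rw [e]
  linarith

open Filter Topology in
theorem aux_lim (B b : ℝ) (hB : 0 < B) (hb : 0 < b) :
    ∃ T : ℝ, 0 < T ∧ ∀ t ≥ T, 1 / (2 * B) ≤ (1 - Real.exp (-B * t)) / B - t * Real.exp (-b * t) := by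
  have h0 : Tendsto (fun t : ℝ => Real.exp (-B * t)) atTop (𝓝 0) := by
    apply Real.tendsto_exp_atBot.comp
    exact tendsto_id.const_mul_atTop_of_neg (by linarith)
  have h1 : Tendsto (fun t : ℝ => t * Real.exp (-b * t)) atTop (𝓝 0) := by
    have := tendsto_rpow_mul_exp_neg_mul_atTop_nhds_zero 1 b hb
    simpa using this
  have h2 : Tendsto (fun t : ℝ => (1 - Real.exp (-B * t)) / B - t * Real.exp (-b * t)) atTop
      (𝓝 ((1 - 0) / B - 0)) := ((h0.const_sub 1).div_const B).sub h1
  have hlt : 1 / (2 * B) < (1 - 0) / B - 0 := by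
    rw [sub_zero, sub_zero]
    exact one_div_lt_one_div_of_lt hB (by linarith)
  have h3 := (h2.eventually (lt_mem_nhds hlt)).and (eventually_gt_atTop 0)
  obtain ⟨T, hT⟩ := eventually_atTop.1 h3
  exact ⟨T, (hT T le_rfl).2, fun t ht => (hT t ht).1.le⟩

open Filter Topology in
theorem aux_small (p A T e : ℝ) (hp : 0 < p) (he : 0 < e) :
    ∃ γ₀ ∈ Set.Ioo (0:ℝ) 1, ∀ γ ∈ Set.Ioo (0:ℝ) γ₀, T ≤ |Real.log γ| ∧ γ ^ p * A ≤ e := by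
  have h1 : Tendsto (fun γ : ℝ => |Real.log γ|) (𝓝[>] 0) atTop :=
    tendsto_abs_atBot_atTop.comp Real.tendsto_log_nhdsGT_zero
  have h2 : Tendsto (fun γ : ℝ => γ ^ p * A) (𝓝[>] 0) (𝓝 0) := by
    have : ContinuousAt (fun γ : ℝ => γ ^ p * A) 0 :=
      (Real.continuousAt_rpow_const 0 p (Or.inr hp.le)).mul_const A
    have h := this.tendsto
    simp only [Real.zero_rpow hp.ne', zero_mul] at h
    exact h.mono_left nhdsWithin_le_nhds
  have h3 := (h1.eventually (eventually_ge_atTop T)).and (h2.eventually (ge_mem_nhds he))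
  obtain ⟨u, hu, hsub⟩ := mem_nhdsGT_iff_exists_Ioo_subset.1 h3
  have hu : 0 < u := hu
  refine ⟨min u (1/2), ⟨by positivity, lt_of_le_of_lt (min_le_right _ _) (by norm_num)⟩, ?_⟩
  intro γ hγ
  exact hsub ⟨hγ.1, lt_of_lt_of_le hγ.2 (min_le_left _ _)⟩

/-- averaging lemma for the irreversal class of possible body motions.
Here ⟨W⟩_t = (1/t)∫_0^t W and t₀ = |ln γ|. -/
theorem averaging_irreversal (p d B₀ Binf Ap Am Vinf : ℝ)
    (hp : 0 < p) (hp2 : p ≤ 2) (hd : 1 ≤ d)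
    (hBB : Binf ≤ B₀) (hBinf : 0 < Binf) (hAp : 0 < Ap) (hAm : 0 < Am) :
    ∃ c > (0:ℝ), ∃ C > (0:ℝ), ∃ γ₀ ∈ Set.Ioo (0:ℝ) 1, ∀ γ ∈ Set.Ioo (0:ℝ) γ₀,
      ∀ W : ℝ → ℝ, ContinuousOn W (Set.Ici 0) →
      (∀ t ≥ (0:ℝ),
        Vinf + γ * Real.exp (-B₀ * t)
            + (if |Real.log γ| + 1 ≤ t then γ ^ (p + 1) * Ap * t ^ (-(p + d)) else 0)
          ≤ W t ∧
        W t ≤ Vinf + γ * Real.exp (-Binf * t) + γ ^ (p + 1) * Am * (1 + t) ^ (-(p + d))) →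
      (∀ t ≥ |Real.log γ|,
        c * γ / t ≤ (1 / t) * (∫ τ in (0:ℝ)..t, W τ) - W t) ∧
      (∀ t > (0:ℝ),
        (1 / t) * (∫ τ in (0:ℝ)..t, W τ) - W t
          ≤ C * (γ + γ ^ (p + 1) * Am) / (1 + t)) := by
  have hB0 : 0 < B₀ := by linarith
  obtain ⟨T, hT0, hT⟩ := aux_lim B₀ Binf hB0 hBinf
  obtain ⟨γ₀, hγ₀, hγ⟩ := aux_small p Am T (1 / (4 * B₀)) hp (by positivity)
  refine ⟨1 / (4 * B₀), by positivity, 1 + 1 / Binf + 1 / p, by positivity, γ₀, hγ₀, ?_⟩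
  intro γ hγm W hWc hW
  obtain ⟨hL, hs⟩ := hγ γ hγm
  have g0 : 0 < γ := hγm.1
  have hWi : ∀ t : ℝ, 0 ≤ t → IntervalIntegrable W volume 0 t := by
    intro t ht
    apply ContinuousOn.intervalIntegrable
    apply hWc.mono
    rw [Set.uIcc_of_le ht]
    exact fun x hx => hx.1
  have hlow : ∀ t ≥ (0:ℝ), Vinf + γ * Real.exp (-B₀ * t) ≤ W t := by
    intro t ht
    have := (hW t ht).1
    split_ifs at this with h
    · have : 0 ≤ γ ^ (p + 1) * Ap * t ^ (-(p + d)) := by positivity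
      linarith
    · linarith
  have hrp : ∀ t ≥ (0:ℝ), (1 + t) ^ (-(p + d)) ≤ (1 + t) ^ (-(p + 1)) := by
    intro t ht
    exact Real.rpow_le_rpow_of_exponent_le (by linarith) (by linarith)
  have hei : ∀ b t : ℝ, IntervalIntegrable (fun τ : ℝ => Real.exp (-b * τ)) volume 0 t :=
    fun b t => Continuous.intervalIntegrable (by fun_prop) _ _
  constructor
  · intro t ht
    have hTt : T ≤ t := hL.trans ht
    have t0 : 0 < t := lt_of_lt_of_le hT0 hTt
    have hI : ∫ τ in (0:ℝ)..t, (Vinf + γ * Real.exp (-B₀ * τ)) ≤ ∫ τ in (0:ℝ)..t, W τ := by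
      apply intervalIntegral.integral_mono_on t0.le
        (Continuous.intervalIntegrable (by fun_prop) _ _) (hWi t t0.le)
      intro x hx
      exact hlow x hx.1
    rw [intervalIntegral.integral_add (by simp) ((hei _ _).const_mul _),
      intervalIntegral.integral_const_mul, aux_exp_int _ _ hB0,
      intervalIntegral.integral_const] at hI
    simp only [sub_zero, smul_eq_mul] at hI
    have hup := (hW t t0.le).2
    have h1 := hT t hTt
    have h2 : t * (1 + t) ^ (-(p + d)) ≤ 1 := by
      have : (1 + t) ^ (-(p + d)) ≤ (1 + t) ^ (-1 : ℝ) :=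
        Real.rpow_le_rpow_of_exponent_le (by linarith) (by linarith)
      rw [Real.rpow_neg_one] at this
      calc t * (1 + t) ^ (-(p + d)) ≤ t * (1 + t)⁻¹ := by gcongr
        _ ≤ 1 := by
          rw [← div_eq_mul_inv, div_le_one (by linarith)]
          linarith
    have h3 : γ ^ (p + 1) = γ ^ p * γ := by
      rw [Real.rpow_add g0, Real.rpow_one]
    have h4 : γ ^ p * Am * (t * (1 + t) ^ (-(p + d))) ≤ 1 / (4 * B₀) := by
      refine le_trans (mul_le_of_le_one_right (by positivity) h2) hs
    have h5 : 1 / (2 * B₀) = 2 * (1 / (4 * B₀)) := by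
      field_simp
      norm_num
    have h6 : t * W t ≤ t * (Vinf + γ * Real.exp (-Binf * t)
        + γ ^ (p + 1) * Am * (1 + t) ^ (-(p + d))) := by gcongr
    rw [h3] at h6
    have h7 : 1 / (4 * B₀) ≤ (1 - Real.exp (-B₀ * t)) / B₀ - t * Real.exp (-Binf * t)
        - γ ^ p * Am * (t * (1 + t) ^ (-(p + d))) := by linarith
    have h8 := mul_le_mul_of_nonneg_left h7 g0.le
    have h9 : 1 / (4 * B₀) * γ ≤ (∫ τ in (0:ℝ)..t, W τ) - t * W t := by linarith
    calc 1 / (4 * B₀) * γ / t ≤ ((∫ τ in (0:ℝ)..t, W τ) - t * W t) / t := by gcongr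
      _ = _ := by field_simp
  · intro t t0
    have hI : ∫ τ in (0:ℝ)..t, W τ ≤ ∫ τ in (0:ℝ)..t, (Vinf + (γ * Real.exp (-Binf * τ)
        + γ ^ (p + 1) * Am * (1 + τ) ^ (-(p + 1)))) := by
      apply intervalIntegral.integral_mono_on t0.le (hWi t t0.le)
      · exact (by simp : IntervalIntegrable (fun _ : ℝ => Vinf) volume 0 t).add
          (((hei _ _).const_mul _).add ((aux_cont_rpow _ _ t0.le).const_mul _))
      · intro x hx
        have h1 := (hW x hx.1).2
        have h2 : γ ^ (p + 1) * Am * (1 + x) ^ (-(p + d))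
            ≤ γ ^ (p + 1) * Am * (1 + x) ^ (-(p + 1)) :=
          mul_le_mul_of_nonneg_left (hrp x hx.1) (by positivity)
        linarith
    rw [intervalIntegral.integral_add (by simp)
      (((hei _ _).const_mul _).add ((aux_cont_rpow _ _ t0.le).const_mul _)),
      intervalIntegral.integral_add ((hei _ _).const_mul _)
        ((aux_cont_rpow _ _ t0.le).const_mul _),
      intervalIntegral.integral_const_mul, intervalIntegral.integral_const_mul,
      intervalIntegral.integral_const] at hI
    simp only [sub_zero, smul_eq_mul] at hI
    have e1 : ∫ τ in (0:ℝ)..t, Real.exp (-Binf * τ) ≤ 1 / Binf := by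
      rw [aux_exp_int _ _ hBinf]
      gcongr
      have := Real.exp_pos (-Binf * t)
      linarith
    have e2 : ∫ τ in (0:ℝ)..t, Real.exp (-Binf * τ) ≤ t := by
      have : ∫ τ in (0:ℝ)..t, Real.exp (-Binf * τ) ≤ ∫ τ in (0:ℝ)..t, (1:ℝ) := by
        apply intervalIntegral.integral_mono_on t0.le (hei _ _) (by simp)
        intro x hx
        apply Real.exp_le_one_iff.2
        nlinarith [hx.1]
      simpa using this
    have r1 := aux_rpow_int p t hp t0.le
    have r2 : ∫ τ in (0:ℝ)..t, (1 + τ) ^ (-(p + 1)) ≤ t := by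
      have : ∫ τ in (0:ℝ)..t, (1 + τ) ^ (-(p + 1)) ≤ ∫ τ in (0:ℝ)..t, (1:ℝ) := by
        apply intervalIntegral.integral_mono_on t0.le (aux_cont_rpow _ _ t0.le) (by simp)
        intro x hx
        exact Real.rpow_le_one_of_one_le_of_nonpos (by linarith [hx.1]) (by linarith)
      simpa using this
    have hV : Vinf ≤ W t := by
      have := hlow t t0.le
      have : 0 < γ * Real.exp (-B₀ * t) := by positivity
      linarith
    have hG : 0 < γ ^ (p + 1) * Am := by positivity
    generalize γ ^ (p + 1) * Am = G at *
    generalize (∫ τ in (0:ℝ)..t, Real.exp (-Binf * τ)) = E at *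
    generalize (∫ τ in (0:ℝ)..t, (1 + τ) ^ (-(p + 1))) = R at *
    generalize (∫ τ in (0:ℝ)..t, W τ) = J at *
    have ib : 0 < 1 / Binf := by positivity
    have ip : 0 < 1 / p := by positivity
    have hE : E * (1 + t) ≤ t * (1 + 1 / Binf + 1 / p) := by nlinarith
    have hR : R * (1 + t) ≤ t * (1 + 1 / Binf + 1 / p) := by nlinarith
    have k1 : J - t * W t ≤ γ * E + G * R := by nlinarith
    have k2 : (J - t * W t) * (1 + t) ≤ t * ((1 + 1 / Binf + 1 / p) * (γ + G)) := by
      have a1 := mul_le_mul_of_nonneg_left hE g0.le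
      have a2 := mul_le_mul_of_nonneg_left hR hG.le
      have a3 := mul_le_mul_of_nonneg_right k1 (by linarith : 0 ≤ 1 + t)
      linarith
    have k3 : 1 / t * J - W t = (J - t * W t) / t := by field_simp
    rw [k3, div_le_div_iff₀ t0 (by linarith)]
    linarith
end

section
/- Let p ∈ (0,2], let d ≥ 1 be a real number, let B₀ ≥ B_∞ > 0 and A₊, A₋ > 0, let K₀ ∈ [1/B₀, 2/B₀], and let V_∞ ∈ ℝ. Then there exist constants c > 0, C > 0 and γ₀ ∈ (0,1) (depending only on p, d, B₀, B_∞, A₊, A₋, K₀) such that for every γ ∈ (0,γ₀), setting t₀ = K₀|ln γ|, every continuous function W : [0,∞) → ℝ satisfying V_∞ + γ e^{−B₀ t} − γ^{p+1} A₊ (1+t)^{−(p+d)} ≤ W(t) ≤ V_∞ + γ e^{−B_∞ t} − γ^{p+1} A₋ t^{−(p+d)} χ{t ≥ t₀+1} for all t ≥ 0 obeys the two bounds: ⟨W⟩_t − W(t) ≥ c γ / t for all t ≥ t₀, and ⟨W⟩_t − W(t) ≤ C (γ + γ^{p+1} A₊) / (1+t) for all t > 0. -/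
open MeasureTheory Real Set

lemma ar_int_exp (B t : ℝ) (hB : 0 < B) :
    ∫ τ in (0:ℝ)..t, Real.exp (-B * τ) = (1 - Real.exp (-B * t)) / B := by
  have h : ∀ x ∈ Set.uIcc 0 t, HasDerivAt (fun x => -(Real.exp (-B * x)) / B)
      (Real.exp (-B * x)) x := by
    intro x _
    have h1 : HasDerivAt (fun x : ℝ => -B * x) (-B) x := by
      simpa using (hasDerivAt_id x).const_mul (-B)
    have h2 := (h1.exp.neg).div_const B
    have e : Real.exp (-B * x) = -(Real.exp (-B * x) * -B) / B := by field_simp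
    rw [e]
    exact h2
  rw [intervalIntegral.integral_eq_sub_of_hasDerivAt h
    ((by fun_prop : Continuous fun x => Real.exp (-B * x)).intervalIntegrable _ _)]
  simp
  ring

lemma ar_cont_rpow (q t : ℝ) (ht : 0 ≤ t) :
    ContinuousOn (fun τ : ℝ => (1 + τ) ^ q) (Set.uIcc 0 t) := by
  apply ContinuousOn.rpow_const (by fun_prop)
  intro x hx
  rw [Set.uIcc_of_le ht] at hx
  left
  linarith [hx.1]

lemma ar_int_rpow (p d t : ℝ) (hp : 0 < p) (hd : 1 ≤ d) (ht : 0 ≤ t) :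
    ∫ τ in (0:ℝ)..t, (1 + τ) ^ (-(p + d)) ≤ 1 / p := by
  have h : ∀ x ∈ Set.uIcc 0 t, HasDerivAt (fun x : ℝ => -((1 + x) ^ (-p)) / p)
      ((1 + x) ^ (-(p + 1))) x := by
    intro x hx
    rw [Set.uIcc_of_le ht] at hx
    have h1 : HasDerivAt (fun x : ℝ => 1 + x) 1 x := (hasDerivAt_id x).const_add 1
    have h2 := ((h1.rpow_const (p := -p) (Or.inl (by linarith [hx.1]))).neg).div_const p
    have e : (1 + x) ^ (-(p + 1)) = -(1 * -p * (1 + x) ^ (-p - 1)) / p := by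
      rw [show -(p + 1) = -p - 1 by ring]
      field_simp
    rw [e]
    exact h2
  have h3 := intervalIntegral.integral_eq_sub_of_hasDerivAt h
    (ar_cont_rpow _ t ht).intervalIntegrable
  have h4 : ∫ τ in (0:ℝ)..t, (1 + τ) ^ (-(p + d)) ≤ ∫ τ in (0:ℝ)..t, (1 + τ) ^ (-(p + 1)) := by
    apply intervalIntegral.integral_mono_on ht (ar_cont_rpow _ t ht).intervalIntegrable
      (ar_cont_rpow _ t ht).intervalIntegrable
    intro x hx
    apply Real.rpow_le_rpow_of_exponent_le <;> linarith [hx.1]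
  have h5 : 0 ≤ (1 + t) ^ (-p) := by positivity
  have h6 : 0 ≤ (1 + t) ^ (-p) / p := by positivity
  rw [h3] at h4
  simp only [add_zero, Real.one_rpow] at h4
  rw [neg_div, neg_div] at h4
  linarith

set_option maxHeartbeats 1600000 in
/-- averaging lemma for the reversal class of possible body motions.
Here ⟨W⟩_t = (1/t)∫_0^t W and t₀ = K₀|ln γ|. -/
theorem averaging_reversal (p d B₀ Binf Ap Am K₀ Vinf : ℝ)
    (hp : 0 < p) (hp2 : p ≤ 2) (hd : 1 ≤ d)
    (hBB : Binf ≤ B₀) (hBinf : 0 < Binf) (hAp : 0 < Ap) (hAm : 0 < Am)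
    (hK₀ : K₀ ∈ Set.Icc (1 / B₀) (2 / B₀)) :
    ∃ c > (0:ℝ), ∃ C > (0:ℝ), ∃ γ₀ ∈ Set.Ioo (0:ℝ) 1, ∀ γ ∈ Set.Ioo (0:ℝ) γ₀,
      ∀ W : ℝ → ℝ, ContinuousOn W (Set.Ici 0) →
      (∀ t ≥ (0:ℝ),
        Vinf + γ * Real.exp (-B₀ * t) - γ ^ (p + 1) * Ap * (1 + t) ^ (-(p + d)) ≤ W t ∧
        W t ≤ Vinf + γ * Real.exp (-Binf * t)
            - (if K₀ * |Real.log γ| + 1 ≤ t then γ ^ (p + 1) * Am * t ^ (-(p + d)) else 0)) →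
      (∀ t ≥ K₀ * |Real.log γ|,
        c * γ / t ≤ (1 / t) * (∫ τ in (0:ℝ)..t, W τ) - W t) ∧
      (∀ t > (0:ℝ),
        (1 / t) * (∫ τ in (0:ℝ)..t, W τ) - W t
          ≤ C * (γ + γ ^ (p + 1) * Ap) / (1 + t)) := by
  obtain ⟨hK1, hK2⟩ := hK₀
  have hB0 : 0 < B₀ := by linarith
  have hK : 0 < K₀ := lt_of_lt_of_le (by positivity) hK1
  set T : ℝ := 1 + 16 * B₀ / Binf ^ 2 with hT
  have hT0 : 0 < T := by positivity
  set ε : ℝ := p / (8 * B₀ * Ap) with hε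
  have hε0 : 0 < ε := by positivity
  refine ⟨1 / (4 * B₀), by positivity, 1 + 1 / Binf, by positivity,
    min (1 / 2) (min (Real.exp (-(T / K₀))) (ε ^ (1 / p))), ⟨by positivity, ?_⟩, ?_⟩
  · exact lt_of_le_of_lt (min_le_left _ _) (by norm_num)
  rintro γ ⟨hγ, hγ0⟩ W hW hb
  obtain ⟨hγ2, hγ3⟩ := lt_min_iff.1 hγ0
  obtain ⟨hγT, hγε⟩ := lt_min_iff.1 hγ3
  have hsplit : γ ^ (p + 1) = γ ^ p * γ := by
    rw [Real.rpow_add hγ, Real.rpow_one]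
  have hWi : ∀ t ≥ (0:ℝ), IntervalIntegrable W volume 0 t := by
    intro t ht
    apply ContinuousOn.intervalIntegrable
    apply hW.mono
    rw [Set.uIcc_of_le ht]
    exact fun x hx => hx.1
  have hEi : ∀ B t : ℝ, IntervalIntegrable (fun x => Real.exp (-B * x)) volume 0 t := fun B t =>
    (by fun_prop : Continuous fun x => Real.exp (-B * x)).intervalIntegrable _ _
  have hup : ∀ t ≥ (0:ℝ), W t ≤ Vinf + γ * Real.exp (-Binf * t) := by
    intro t ht
    have := (hb t ht).2
    have h2 : 0 ≤ (if K₀ * |Real.log γ| + 1 ≤ t then γ ^ (p + 1) * Am * t ^ (-(p + d)) else 0) := by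
      split_ifs <;> positivity
    linarith
  have hg1 : 0 < γ ^ (p + 1) := by positivity
  constructor
  · intro t ht
    have hlog : Real.log γ < -(T / K₀) := by
      rw [← Real.log_exp (-(T / K₀))]
      exact Real.log_lt_log hγ hγT
    have hTK : 0 < T / K₀ := by positivity
    have habs : |Real.log γ| = -Real.log γ := abs_of_neg (by linarith)
    rw [habs] at ht
    have htT : T ≤ t := by
      have : K₀ * (T / K₀) = T := by field_simp
      nlinarith
    have ht0 : 0 < t := by linarith
    have hexp0 : Real.exp (-B₀ * t) ≤ 1 / 2 := by
      have h1 : -B₀ * t ≤ Real.log γ := by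
        have h2 : 1 ≤ B₀ * K₀ := by
          rw [div_le_iff₀ hB0] at hK1
          linarith
        have h3 : B₀ * (K₀ * -Real.log γ) ≤ B₀ * t := mul_le_mul_of_nonneg_left ht hB0.le
        nlinarith
      have h4 := Real.exp_le_exp.2 h1
      rw [Real.exp_log hγ] at h4
      linarith
    have hexp1 : t * Real.exp (-Binf * t) ≤ 1 / (8 * B₀) := by
      have h1 := Real.quadratic_le_exp_of_nonneg (x := Binf * t) (by positivity)
      have h2 : 8 * B₀ * t ≤ Real.exp (Binf * t) := by
        have h3 : 16 * B₀ / Binf ^ 2 ≤ t := by linarith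
        rw [div_le_iff₀ (by positivity)] at h3
        have h4 : 0 < Binf * t := by positivity
        nlinarith
      rw [neg_mul, Real.exp_neg, ← div_eq_mul_inv, div_le_div_iff₀ (Real.exp_pos _) (by positivity)]
      linarith
    have hγp : γ ^ p * (Ap / p) ≤ 1 / (8 * B₀) := by
      have h1 : γ ^ p ≤ ε := by
        have := Real.rpow_le_rpow hγ.le hγε.le hp.le
        rwa [← Real.rpow_mul hε0.le, one_div_mul_cancel hp.ne', Real.rpow_one] at this
      calc γ ^ p * (Ap / p) ≤ ε * (Ap / p) := by gcongr
        _ = 1 / (8 * B₀) := by rw [hε]; field_simp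
    have hci := (ar_cont_rpow (-(p + d)) t ht0.le).intervalIntegrable (μ := volume)
    have hint : ∫ τ in (0:ℝ)..t, (Vinf + γ * Real.exp (-B₀ * τ)
        - γ ^ (p + 1) * Ap * (1 + τ) ^ (-(p + d))) ≤ ∫ τ in (0:ℝ)..t, W τ := by
      apply intervalIntegral.integral_mono_on ht0.le _ (hWi t ht0.le)
      · intro x hx
        exact (hb x hx.1).1
      · exact (intervalIntegrable_const.add ((hEi _ _).const_mul _)).sub (hci.const_mul _)
    rw [intervalIntegral.integral_sub (intervalIntegrable_const.add ((hEi _ _).const_mul _))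
      (hci.const_mul _), intervalIntegral.integral_add intervalIntegrable_const
      ((hEi _ _).const_mul _), intervalIntegral.integral_const_mul,
      intervalIntegral.integral_const_mul, ar_int_exp _ _ hB0, intervalIntegral.integral_const,
      smul_eq_mul, sub_zero] at hint
    have hr := ar_int_rpow p d t hp hd ht0.le
    have hr2 : γ ^ (p + 1) * Ap * ∫ τ in (0:ℝ)..t, (1 + τ) ^ (-(p + d)) ≤ γ * (1 / (8 * B₀)) := by
      calc _ ≤ γ ^ (p + 1) * Ap * (1 / p) := by gcongr
        _ = γ * (γ ^ p * (Ap / p)) := by rw [hsplit]; ring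
        _ ≤ _ := by gcongr
    have he : γ * (1 / (2 * B₀)) ≤ γ * ((1 - Real.exp (-B₀ * t)) / B₀) := by
      apply mul_le_mul_of_nonneg_left _ hγ.le
      rw [div_le_div_iff₀ (by positivity) hB0]
      nlinarith
    have hWt := mul_le_mul_of_nonneg_left (hup t ht0.le) ht0.le
    have hfin : γ * (t * Real.exp (-Binf * t)) ≤ γ * (1 / (8 * B₀)) := by gcongr
    have e1 : (1 / t) * (∫ τ in (0:ℝ)..t, W τ) - W t = ((∫ τ in (0:ℝ)..t, W τ) - t * W t) / t := by
      field_simp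
    rw [e1]
    apply div_le_div_of_nonneg_right _ ht0.le
    have e2 : γ * (1 / (2 * B₀)) = 4 * (γ * (1 / (8 * B₀))) := by field_simp; norm_num
    have e3 : 1 / (4 * B₀) * γ = 2 * (γ * (1 / (8 * B₀))) := by field_simp; norm_num
    rw [e3]
    rw [e2] at he
    nlinarith
  · intro t ht
    have hint : ∫ τ in (0:ℝ)..t, W τ ≤ ∫ τ in (0:ℝ)..t, (Vinf + γ * Real.exp (-Binf * τ)) := by
      apply intervalIntegral.integral_mono_on ht.le (hWi t ht.le)
      · exact intervalIntegrable_const.add ((hEi _ _).const_mul _)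
      · intro x hx
        exact hup x hx.1
    rw [intervalIntegral.integral_add intervalIntegrable_const
      ((hEi _ _).const_mul _), intervalIntegral.integral_const_mul,
      ar_int_exp _ _ hBinf, intervalIntegral.integral_const,
      smul_eq_mul, sub_zero] at hint
    have hlow := (hb t ht.le).1
    have hq : (1 + t) ^ (-(p + d)) ≤ 1 / (1 + t) := by
      rw [one_div, ← Real.rpow_neg_one]
      apply Real.rpow_le_rpow_of_exponent_le <;> linarith
    have hq2 : γ ^ (p + 1) * Ap * (1 + t) ^ (-(p + d)) ≤ γ ^ (p + 1) * Ap * (1 / (1 + t)) := by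
      gcongr
    have hE : (1 - Real.exp (-Binf * t)) / Binf * (1 + t) ≤ (1 + 1 / Binf) * t := by
      have h1 := Real.add_one_le_exp (-Binf * t)
      have h2 := Real.exp_pos (-Binf * t)
      have e : (1 + 1 / Binf) * t = (Binf * t + t) / Binf := by field_simp
      rw [e, div_mul_eq_mul_div]
      apply div_le_div_of_nonneg_right _ hBinf.le
      nlinarith
    have hE2 : (1 - Real.exp (-Binf * t)) / Binf ≤ (1 + 1 / Binf) * t / (1 + t) := by
      rwa [le_div_iff₀ (by positivity)]
    have hI : (1 / t) * (∫ τ in (0:ℝ)..t, W τ) ≤ Vinf + γ * ((1 + 1 / Binf) / (1 + t)) := by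
      calc _ ≤ (1 / t) * (t * Vinf + γ * ((1 + 1 / Binf) * t / (1 + t))) := by
            gcongr
            exact hint.trans (by gcongr)
        _ = _ := by
            have h1 : 1 + t ≠ 0 := by positivity
            generalize 1 + 1 / Binf = M
            field_simp
    have hx : 0 < γ * Real.exp (-B₀ * t) := by positivity
    have hy : 0 ≤ 1 / Binf * (γ ^ (p + 1) * Ap * (1 / (1 + t))) := by positivity
    have e : (1 + 1 / Binf) * (γ + γ ^ (p + 1) * Ap) / (1 + t) =
      γ * ((1 + 1 / Binf) / (1 + t)) + γ ^ (p + 1) * Ap * (1 / (1 + t)) +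
        1 / Binf * (γ ^ (p + 1) * Ap * (1 / (1 + t))) := by ring
    rw [e]
    linarith
end

section
/- Let p ∈ (0,2], let d ≥ 1 be a real number, let B₀ ≥ B_∞ > 0, let c₁, C > 0, and let V_∞ ∈ ℝ. Then there exist constants A₊ > 0 (one may take A₊ = c₁ e^{−B₀}), A₋ > 0 and γ₀ ∈ (0,1) such that the following holds for every γ ∈ (0,γ₀), with t₀ = |ln γ|. Let Q : [0,∞) → ℝ be continuous with B_∞ ≤ Q(t) ≤ B₀ for all t, and let R : [0,∞) → ℝ be continuous with R(t) ≤ −c₁ γ^{p+1} t^{−(p+d)} χ{t ≥ t₀} (so in particular R(t) ≤ 0) and R(t) ≥ −C (γ + γ^{p+1} A₋)^{p+1} (1+t)^{−(p+d)} for all t ≥ 0. Define V(t) = V_∞ + γ e^{−∫_0^t Q(r)dr} − ∫_0^t e^{−∫_s^t Q(r)dr} R(s) ds, which is the solution of dV/dt = Q(t)(V_∞ − V) − R(t) with V(0) = V_∞ + γ. Then for all t ≥ 0: γ e^{−B₀ t} + A₊ γ^{p+1} t^{−(p+d)} χ{t ≥ t₀+1} ≤ V(t) − V_∞ ≤ γ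 e^{−B_∞ t} + A₋ γ^{p+1} (1+t)^{−(p+d)}; in particular V(t) > V_∞ for all t ≥ 0. -/
open MeasureTheory Real Set


/-- Bounds on the integral of the rate. -/
lemma aux_Q (q : ℝ → ℝ) (hq : Continuous q) (B₀ B : ℝ) (hb : ∀ t, B ≤ q t ∧ q t ≤ B₀)
    (s t : ℝ) (hst : s ≤ t) :
    B * (t - s) ≤ (∫ r in s..t, q r) ∧ (∫ r in s..t, q r) ≤ B₀ * (t - s) := by
  constructor
  · have h := intervalIntegral.integral_mono_on (f := fun _ => B) (g := q) (μ := volume) hst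
      (by simp) (hq.intervalIntegrable _ _) (fun x _ => (hb x).1)
    simp only [intervalIntegral.integral_const, smul_eq_mul] at h
    linarith
  · have h := intervalIntegral.integral_mono_on (g := fun _ => B₀) (f := q) (μ := volume) hst
      (hq.intervalIntegrable _ _) (by simp) (fun x _ => (hb x).2)
    simp only [intervalIntegral.integral_const, smul_eq_mul] at h
    linarith

lemma aux_cont (q ρ : ℝ → ℝ) (hq : Continuous q) (hρ : Continuous ρ) (t : ℝ) :
    Continuous (fun s => Real.exp (-(∫ r in s..t, q r)) * ρ s) := by
  have h : Continuous (fun s => ∫ r in t..s, q r) :=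
    intervalIntegral.continuous_primitive (fun a b => hq.intervalIntegrable a b) t
  have e : (fun s => Real.exp (-(∫ r in s..t, q r)) * ρ s)
      = fun s => Real.exp (∫ r in t..s, q r) * ρ s := by
    funext s
    rw [intervalIntegral.integral_symm t s, neg_neg]
  rw [e]
  exact (Real.continuous_exp.comp h).mul hρ

/-- Polynomial growth is dominated by the exponential. -/
lemma aux_poly (B k : ℝ) (hB : 0 < B) (hk : 0 < k) :
    ∃ M > (0:ℝ), ∀ u ≥ (0:ℝ), (1 + u) ^ k ≤ M * Real.exp (B / 2 * u) := by
  obtain ⟨a, ha, hak⟩ : ∃ a > (0:ℝ), a * k = B / 2 := ⟨B / (2 * k), by positivity, by field_simp⟩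
  refine ⟨(1 + 1 / a) ^ k, by positivity, fun u hu => ?_⟩
  have h1 : 1 + u ≤ (1 + 1 / a) * Real.exp (a * u) := by
    have h2 := Real.add_one_le_exp (a * u)
    have h3 : (1 + 1 / a) * (a * u + 1) ≤ (1 + 1 / a) * Real.exp (a * u) := by gcongr
    have h4 : (1 + 1 / a) * (a * u + 1) = a * u + 1 + u + 1 / a := by field_simp; ring
    have : 0 < 1 / a := by positivity
    have : 0 ≤ a * u := by positivity
    linarith
  calc (1 + u) ^ k ≤ ((1 + 1 / a) * Real.exp (a * u)) ^ k := by gcongr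
    _ = (1 + 1 / a) ^ k * Real.exp (B / 2 * u) := by
      rw [Real.mul_rpow (by positivity) (by positivity), ← Real.exp_mul, ← hak]
      ring_nf

/-- Pointwise bound for the convolution kernel. -/
lemma aux_pt (B k M : ℝ) (hk : 0 < k)
    (hM : ∀ u ≥ (0:ℝ), (1 + u) ^ k ≤ M * Real.exp (B / 2 * u)) (s t : ℝ) (hs : 0 ≤ s)
    (hst : s ≤ t) :
    Real.exp (-(B * (t - s))) * (1 + s) ^ (-k)
      ≤ M * (1 + t) ^ (-k) * Real.exp (-(B / 2 * (t - s))) := by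
  have h1 : (1 + s) ^ (-k) ≤ (1 + t) ^ (-k) * (1 + (t - s)) ^ k := by
    have h2 : (1 + t) ^ k ≤ (1 + s) ^ k * (1 + (t - s)) ^ k := by
      rw [← Real.mul_rpow (by linarith) (by linarith)]
      apply Real.rpow_le_rpow (by linarith) _ hk.le
      nlinarith [mul_nonneg hs (sub_nonneg.2 hst)]
    have p1 : 0 < (1 + s) ^ k := Real.rpow_pos_of_pos (by linarith) _
    have p2 : 0 < (1 + t) ^ k := Real.rpow_pos_of_pos (by linarith) _
    rw [Real.rpow_neg (by linarith), Real.rpow_neg (by linarith), inv_mul_eq_div, le_div_iff₀ p2,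
      inv_mul_le_iff₀ p1]
    exact h2
  have h3 := hM (t - s) (by linarith)
  have p3 : 0 < (1 + t) ^ (-k) := Real.rpow_pos_of_pos (by linarith) _
  have e : Real.exp (-(B / 2 * (t - s)))
      = Real.exp (-(B * (t - s))) * Real.exp (B / 2 * (t - s)) := by
    rw [← Real.exp_add]; ring_nf
  calc Real.exp (-(B * (t - s))) * (1 + s) ^ (-k)
      ≤ Real.exp (-(B * (t - s))) * ((1 + t) ^ (-k) * (M * Real.exp (B / 2 * (t - s)))) := by
        gcongr
        exact h1.trans (by gcongr)
    _ = _ := by rw [e]; ring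

lemma aux_int (b t : ℝ) (hb : 0 < b) :
    (∫ s in (0:ℝ)..t, Real.exp (-(b * (t - s)))) ≤ 1 / b := by
  have h : ∀ s ∈ Set.uIcc 0 t, HasDerivAt (fun s => Real.exp (-(b * (t - s))) / b)
      (Real.exp (-(b * (t - s)))) s := by
    intro s _
    have h1 : HasDerivAt (fun s => -(b * (t - s))) b s := by
      have h0 : HasDerivAt (fun s => -(b * (t - s))) (-(b * -1)) s :=
        (((hasDerivAt_id s).const_sub t).const_mul b).neg
      rwa [show -(b * -1) = b by ring] at h0
    have h2 := h1.exp.div_const b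
    rwa [mul_div_cancel_right₀ _ hb.ne'] at h2
  rw [intervalIntegral.integral_eq_sub_of_hasDerivAt h
    (Continuous.intervalIntegrable (by fun_prop) _ _)]
  have : 0 < Real.exp (-(b * (t - 0))) / b := by positivity
  simp only [sub_self, mul_zero, neg_zero, Real.exp_zero]
  linarith

lemma aux_upper (q ρ : ℝ → ℝ) (hq : Continuous q) (hρ : Continuous ρ) (B B₀ k M D : ℝ)
    (hB : 0 < B) (hk : 0 < k) (hD : 0 < D) (hM0 : 0 < M)
    (hM : ∀ u ≥ (0:ℝ), (1 + u) ^ k ≤ M * Real.exp (B / 2 * u))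
    (hb : ∀ t, B ≤ q t ∧ q t ≤ B₀) (t : ℝ) (ht : 0 ≤ t)
    (hR : ∀ s ≥ (0:ℝ), -(D * (1 + s) ^ (-k)) ≤ ρ s) :
    -(∫ s in (0:ℝ)..t, Real.exp (-(∫ r in s..t, q r)) * ρ s)
      ≤ D * (M * (2 / B)) * (1 + t) ^ (-k) := by
  rw [← intervalIntegral.integral_neg]
  have p3 : 0 < (1 + t) ^ (-k) := Real.rpow_pos_of_pos (by linarith) _
  calc (∫ s in (0:ℝ)..t, -(Real.exp (-(∫ r in s..t, q r)) * ρ s))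
      ≤ ∫ s in (0:ℝ)..t, D * (M * (1 + t) ^ (-k)) * Real.exp (-(B / 2 * (t - s))) := by
        apply intervalIntegral.integral_mono_on ht
        · exact ((aux_cont q ρ hq hρ t).neg).intervalIntegrable _ _
        · exact Continuous.intervalIntegrable (by fun_prop) _ _
        · intro s hs
          have h1 := aux_pt B k M hk hM s t hs.1 hs.2
          have h2 := (aux_Q q hq B₀ B hb s t hs.2).1
          have h3 : Real.exp (-(∫ r in s..t, q r)) ≤ Real.exp (-(B * (t - s))) :=
            Real.exp_le_exp.2 (by linarith)
          have p4 : 0 < (1 + s) ^ (-k) := Real.rpow_pos_of_pos (by linarith [hs.1]) _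
          have h4 := hR s hs.1
          calc -(Real.exp (-(∫ r in s..t, q r)) * ρ s)
              = Real.exp (-(∫ r in s..t, q r)) * (-ρ s) := by ring
            _ ≤ Real.exp (-(∫ r in s..t, q r)) * (D * (1 + s) ^ (-k)) := by
                gcongr; linarith
            _ ≤ Real.exp (-(B * (t - s))) * (D * (1 + s) ^ (-k)) := by gcongr
            _ = D * (Real.exp (-(B * (t - s))) * (1 + s) ^ (-k)) := by ring
            _ ≤ D * (M * (1 + t) ^ (-k) * Real.exp (-(B / 2 * (t - s)))) := by gcongr
            _ = _ := by ring
    _ = D * (M * (1 + t) ^ (-k)) * ∫ s in (0:ℝ)..t, Real.exp (-(B / 2 * (t - s))) := by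
        rw [intervalIntegral.integral_const_mul]
    _ ≤ D * (M * (1 + t) ^ (-k)) * (1 / (B / 2)) := by
        have := aux_int (B / 2) t (by positivity)
        gcongr
    _ = _ := by field_simp

lemma aux_lower (q ρ : ℝ → ℝ) (hq : Continuous q) (hρ : Continuous ρ) (B B₀ k c t₀ : ℝ)
    (hB0 : 0 < B₀) (hk : 0 < k) (hc : 0 < c) (ht₀ : 0 < t₀)
    (hb : ∀ t, B ≤ q t ∧ q t ≤ B₀) (t : ℝ) (ht : 0 ≤ t)
    (hR : ∀ s ≥ (0:ℝ), ρ s ≤ -(if t₀ ≤ s then c * s ^ (-k) else 0)) :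
    (if t₀ + 1 ≤ t then Real.exp (-B₀) * c * t ^ (-k) else 0) ≤
    -(∫ s in (0:ℝ)..t, Real.exp (-(∫ r in s..t, q r)) * ρ s) := by
  rw [← intervalIntegral.integral_neg]
  have hc' : Continuous (fun s => -(Real.exp (-(∫ r in s..t, q r)) * ρ s)) :=
    (aux_cont q ρ hq hρ t).neg
  have hρ0 : ∀ s ≥ (0:ℝ), ρ s ≤ 0 := by
    intro s hs
    have h := hR s hs
    split_ifs at h with h1
    · have : 0 < c * s ^ (-k) := mul_pos hc (Real.rpow_pos_of_pos (by linarith) _)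
      linarith
    · linarith
  have hnn : ∀ s ≥ (0:ℝ), 0 ≤ -(Real.exp (-(∫ r in s..t, q r)) * ρ s) := by
    intro s hs
    have := mul_nonneg (Real.exp_pos (-(∫ r in s..t, q r))).le (neg_nonneg.2 (hρ0 s hs))
    linarith
  split_ifs with h
  · rw [← intervalIntegral.integral_add_adjacent_intervals (b := t - 1)
      (hc'.intervalIntegrable _ _) (hc'.intervalIntegrable _ _)]
    have h1 : 0 ≤ ∫ s in (0:ℝ)..(t-1), -(Real.exp (-(∫ r in s..t, q r)) * ρ s) :=
      intervalIntegral.integral_nonneg (by linarith) (fun s hs => hnn s hs.1)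
    have h2 := intervalIntegral.integral_mono_on (μ := volume) (a := t - 1) (b := t)
      (f := fun _ => Real.exp (-B₀) * c * t ^ (-k))
      (g := fun s => -(Real.exp (-(∫ r in s..t, q r)) * ρ s)) (by linarith)
      (by simp) (hc'.intervalIntegrable _ _) (by
        intro s hs
        have hs0 : 0 < s := by linarith [hs.1]
        have h3 := (aux_Q q hq B₀ B hb s t hs.2).2
        have h4 := hR s hs0.le
        rw [if_pos (by linarith [hs.1])] at h4
        have h5 : t ^ (-k) ≤ s ^ (-k) :=
          Real.rpow_le_rpow_of_nonpos hs0 hs.2 (by linarith)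
        have h6 : Real.exp (-B₀) ≤ Real.exp (-(∫ r in s..t, q r)) := by
          apply Real.exp_le_exp.2
          have : B₀ * (t - s) ≤ B₀ * 1 := by
            apply mul_le_mul_of_nonneg_left _ hB0.le
            linarith [hs.1]
          linarith
        have p : 0 < s ^ (-k) := Real.rpow_pos_of_pos hs0 _
        calc Real.exp (-B₀) * c * t ^ (-k) ≤ Real.exp (-B₀) * c * s ^ (-k) := by gcongr
          _ = Real.exp (-B₀) * (c * s ^ (-k)) := by ring
          _ ≤ Real.exp (-(∫ r in s..t, q r)) * (c * s ^ (-k)) := by gcongr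
          _ ≤ Real.exp (-(∫ r in s..t, q r)) * (- ρ s) := by gcongr; linarith
          _ = _ := by ring)
    simp only [intervalIntegral.integral_const, smul_eq_mul] at h2
    linarith
  · exact intervalIntegral.integral_nonneg ht (fun s hs => hnn s hs.1)

/-- the Duhamel iteration estimate in the irreversal case, with t₀ = |ln γ|.
The new motion V generated by the iteration map stays in the irreversal class; in
particular V(t) > V_∞ for all t ≥ 0. -/
theorem iteration_irreversal (p d B₀ Binf c₁ C Vinf : ℝ)
    (hp : 0 < p) (hp2 : p ≤ 2) (hd : 1 ≤ d)
    (hBB : Binf ≤ B₀) (hBinf : 0 < Binf) (hc₁ : 0 < c₁) (hC : 0 < C) :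
    ∃ Ap > (0:ℝ), Ap = c₁ * Real.exp (-B₀) ∧ ∃ Am > (0:ℝ), ∃ γ₀ ∈ Set.Ioo (0:ℝ) 1,
      ∀ γ ∈ Set.Ioo (0:ℝ) γ₀, ∀ Q R V : ℝ → ℝ,
      ContinuousOn Q (Set.Ici 0) → ContinuousOn R (Set.Ici 0) →
      (∀ t ≥ (0:ℝ), Binf ≤ Q t ∧ Q t ≤ B₀) →
      (∀ t ≥ (0:ℝ),
        R t ≤ -(if |Real.log γ| ≤ t then c₁ * γ ^ (p + 1) * t ^ (-(p + d)) else 0)) →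
      (∀ t ≥ (0:ℝ),
        -(C * (γ + γ ^ (p + 1) * Am) ^ (p + 1) * (1 + t) ^ (-(p + d))) ≤ R t) →
      (∀ t : ℝ, V t = Vinf + γ * Real.exp (-(∫ r in (0:ℝ)..t, Q r))
          - ∫ s in (0:ℝ)..t, Real.exp (-(∫ r in s..t, Q r)) * R s) →
      ∀ t ≥ (0:ℝ),
        (γ * Real.exp (-B₀ * t)
            + (if |Real.log γ| + 1 ≤ t then Ap * γ ^ (p + 1) * t ^ (-(p + d)) else 0)
          ≤ V t - Vinf) ∧
        (V t - Vinf ≤ γ * Real.exp (-Binf * t) + Am * γ ^ (p + 1) * (1 + t) ^ (-(p + d))) ∧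
        Vinf < V t := by
  have hk : 0 < p + d := by linarith
  have hB0 : 0 < B₀ := by linarith
  obtain ⟨M, hM0, hM⟩ := aux_poly Binf (p + d) hBinf hk
  refine ⟨c₁ * Real.exp (-B₀), by positivity, rfl, ?_⟩
  obtain ⟨Am, hAm⟩ : ∃ Am, Am = C * 2 ^ (p + 1) * (M * (2 / Binf)) := ⟨_, rfl⟩
  have hAm0 : 0 < Am := by rw [hAm]; positivity
  have hx : 0 < (1 / Am) ^ (1 / p) := by positivity
  refine ⟨Am, hAm0, min (1 / 2) ((1 / Am) ^ (1 / p)), ⟨lt_min (by norm_num) hx,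
    (min_le_left _ _).trans_lt (by norm_num)⟩, ?_⟩
  rintro γ ⟨hγ0, hγ⟩ Q R V hQ hR hQb hRu hRl hV t ht
  have hγ1 : γ < 1 := (hγ.trans_le (min_le_left _ _)).trans (by norm_num)
  have hγ2 : γ ^ p * Am ≤ 1 := by
    have h1 : γ ^ p ≤ ((1 / Am) ^ (1 / p)) ^ p :=
      Real.rpow_le_rpow hγ0.le (hγ.trans_le (min_le_right _ _)).le hp.le
    rw [← Real.rpow_mul (by positivity), one_div_mul_cancel hp.ne', Real.rpow_one] at h1
    exact (le_div_iff₀ hAm0).1 h1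
  have ht₀ : 0 < |Real.log γ| := abs_pos.2 (Real.log_neg hγ0 hγ1).ne
  have hpow : (γ + γ ^ (p + 1) * Am) ^ (p + 1) ≤ 2 ^ (p + 1) * γ ^ (p + 1) := by
    rw [← Real.mul_rpow (by norm_num) hγ0.le]
    apply Real.rpow_le_rpow (by positivity) _ (by linarith)
    rw [Real.rpow_add hγ0, Real.rpow_one]
    nlinarith
  -- continuous extensions
  obtain ⟨q, hq⟩ : ∃ q : ℝ → ℝ, q = fun s => Q (max s 0) := ⟨_, rfl⟩
  obtain ⟨ρ, hρ⟩ : ∃ ρ : ℝ → ℝ, ρ = fun s => R (max s 0) := ⟨_, rfl⟩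
  have hqc : Continuous q := by
    rw [hq]
    exact hQ.comp_continuous (by fun_prop) (fun x => Set.mem_Ici.2 (le_max_right _ _))
  have hρc : Continuous ρ := by
    rw [hρ]
    exact hR.comp_continuous (by fun_prop) (fun x => Set.mem_Ici.2 (le_max_right _ _))
  have hqe : ∀ s ≥ (0:ℝ), q s = Q s := fun s hs => by rw [hq]; simp [max_eq_left hs]
  have hρe : ∀ s ≥ (0:ℝ), ρ s = R s := fun s hs => by rw [hρ]; simp [max_eq_left hs]
  have hqb : ∀ s, Binf ≤ q s ∧ q s ≤ B₀ := fun s => by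
    rw [hq]; exact hQb _ (le_max_right _ _)
  have hI : ∀ s ≥ (0:ℝ), (∫ r in s..t, Q r) = ∫ r in s..t, q r := by
    intro s hs
    apply intervalIntegral.integral_congr
    intro r hr
    exact (hqe r ((le_min hs ht).trans hr.1)).symm
  have hJ : (∫ s in (0:ℝ)..t, Real.exp (-(∫ r in s..t, Q r)) * R s)
      = ∫ s in (0:ℝ)..t, Real.exp (-(∫ r in s..t, q r)) * ρ s := by
    apply intervalIntegral.integral_congr
    intro s hs
    have hs0 : 0 ≤ s := (le_min le_rfl ht).trans hs.1
    simp only [hI s hs0, hρe s hs0]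
  have hVt : V t - Vinf = γ * Real.exp (-(∫ r in (0:ℝ)..t, q r))
      + -(∫ s in (0:ℝ)..t, Real.exp (-(∫ r in s..t, q r)) * ρ s) := by
    rw [hV t, hI 0 le_rfl, hJ]; ring
  obtain ⟨hq1, hq2⟩ := aux_Q q hqc B₀ Binf hqb 0 t ht
  have hup := aux_upper q ρ hqc hρc Binf B₀ (p + d) M (C * (γ + γ ^ (p + 1) * Am) ^ (p + 1))
    hBinf hk (by positivity) hM0 hM hqb t ht (fun s hs => by rw [hρe s hs]; exact hRl s hs)
  have hlo := aux_lower q ρ hqc hρc Binf B₀ (p + d) (c₁ * γ ^ (p + 1)) |Real.log γ|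
    hB0 hk (by positivity) ht₀ hqb t ht (fun s hs => by rw [hρe s hs]; exact hRu s hs)
  have pt : 0 < (1 + t) ^ (-(p + d)) := Real.rpow_pos_of_pos (by linarith) _
  have e1 : γ * Real.exp (-B₀ * t) ≤ γ * Real.exp (-(∫ r in (0:ℝ)..t, q r)) := by
    gcongr; linarith
  have e2 : γ * Real.exp (-(∫ r in (0:ℝ)..t, q r)) ≤ γ * Real.exp (-Binf * t) := by
    gcongr; linarith
  have hL : γ * Real.exp (-B₀ * t)
            + (if |Real.log γ| + 1 ≤ t then
                c₁ * Real.exp (-B₀) * γ ^ (p + 1) * t ^ (-(p + d)) else 0)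
          ≤ V t - Vinf := by
    rw [hVt]
    refine add_le_add e1 (le_trans (le_of_eq ?_) hlo)
    split_ifs
    · ring
    · rfl
  refine ⟨hL, ?_, ?_⟩
  · rw [hVt]
    refine add_le_add e2 (hup.trans ?_)
    calc C * (γ + γ ^ (p + 1) * Am) ^ (p + 1) * (M * (2 / Binf)) * (1 + t) ^ (-(p + d))
        ≤ C * (2 ^ (p + 1) * γ ^ (p + 1)) * (M * (2 / Binf)) * (1 + t) ^ (-(p + d)) := by
          gcongr
      _ = Am * γ ^ (p + 1) * (1 + t) ^ (-(p + d)) := by rw [hAm]; ring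
  · have h1 : 0 < γ * Real.exp (-B₀ * t) := by positivity
    have h2 : (0:ℝ) ≤ (if |Real.log γ| + 1 ≤ t then
                c₁ * Real.exp (-B₀) * γ ^ (p + 1) * t ^ (-(p + d)) else 0) := by
      split_ifs
      · positivity
      · rfl
    linarith
end

section
/- Let α, β > 0 and for V ≥ 0 define Φ(V) = 2β ∫_V^∞ (z − V) e^{−α z²} dz − e^{−α V²}. If β < α, then there exists ε > 0 such that Φ(V) < 0 for all V ∈ [0, ε) (the Reversal Criterion holds for all sufficiently small equilibrium speeds). If β > α, then there exists ε > 0 such that Φ(V) > 0 for all V ∈ [0, ε) (the Irreversal Criterion holds for all sufficiently small equilibrium speeds). -/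
open MeasureTheory Real Set

lemma gss_int (α V : ℝ) (hα : 0 < α) :
    (∫ z in Set.Ioi V, (z - V) * Real.exp (-(α * z ^ 2)))
      = Real.exp (-(α * V ^ 2)) / (2 * α)
        - V * ∫ z in Set.Ioi V, Real.exp (-(α * z ^ 2)) := by
  have i0 : Integrable (fun z : ℝ => Real.exp (-(α * z ^ 2))) := by
    simpa using integrable_exp_neg_mul_sq hα
  have i1 : Integrable (fun z : ℝ => z * Real.exp (-(α * z ^ 2))) := by
    simpa using integrable_mul_exp_neg_mul_sq hα
  have h1 : (∫ z in Set.Ioi V, z * Real.exp (-(α * z ^ 2)))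
      = 0 - (-(Real.exp (-(α * V ^ 2)) / (2 * α))) := by
    refine integral_Ioi_of_hasDerivAt_of_tendsto'
      (f := fun z : ℝ => -(Real.exp (-(α * z ^ 2)) / (2 * α))) (fun x _ => ?_) i1.integrableOn ?_
    · have := ((((hasDerivAt_pow 2 x).const_mul α).neg.exp).div_const (2 * α)).neg
      convert! this using 1
      simp
      field_simp
    · have h : Filter.Tendsto (fun z : ℝ => α * z ^ 2) Filter.atTop Filter.atTop :=
        (Filter.tendsto_pow_atTop two_ne_zero).const_mul_atTop hα
      have := ((Real.tendsto_exp_neg_atTop_nhds_zero.comp h).div_const (2 * α)).neg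
      simpa [Function.comp_def] using this
  simp_rw [sub_mul]
  rw [integral_sub i1.integrableOn (i0.const_mul V).integrableOn, h1, integral_const_mul]
  ring

/-- for the Gaussian example, Φ(V) = 2β∫_V^∞ (z−V)e^{−αz²}dz − e^{−αV²}.
If β < α, the Reversal Criterion Φ < 0 holds for all sufficiently small V ≥ 0;
if β > α, the Irreversal Criterion Φ > 0 holds for all sufficiently small V ≥ 0. -/
theorem gaussian_small_speed (α β : ℝ) (hα : 0 < α) (hβ : 0 < β) :
    (β < α → ∃ ε > (0:ℝ), ∀ V : ℝ, 0 ≤ V → V < ε →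
      2 * β * (∫ z in Set.Ioi V, (z - V) * Real.exp (-(α * z ^ 2)))
        - Real.exp (-(α * V ^ 2)) < 0) ∧
    (α < β → ∃ ε > (0:ℝ), ∀ V : ℝ, 0 ≤ V → V < ε →
      0 < 2 * β * (∫ z in Set.Ioi V, (z - V) * Real.exp (-(α * z ^ 2)))
        - Real.exp (-(α * V ^ 2))) := by
  have key : ∀ V : ℝ, 2 * β * (∫ z in Set.Ioi V, (z - V) * Real.exp (-(α * z ^ 2)))
        - Real.exp (-(α * V ^ 2)) = (β / α - 1) * Real.exp (-(α * V ^ 2))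
        - 2 * β * V * ∫ z in Set.Ioi V, Real.exp (-(α * z ^ 2)) := by
    intro V
    rw [gss_int α V hα]
    field_simp
    ring
  have i0 : Integrable (fun z : ℝ => Real.exp (-(α * z ^ 2))) := by
    simpa using integrable_exp_neg_mul_sq hα
  simp_rw [key]
  constructor
  · intro h
    refine ⟨1, one_pos, fun V hV _ => ?_⟩
    have hG : 0 ≤ ∫ z in Set.Ioi V, Real.exp (-(α * z ^ 2)) :=
      integral_nonneg fun z => (Real.exp_pos _).le
    have h2 : β / α - 1 < 0 := by rw [sub_neg, div_lt_one hα]; exact h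
    have h3 := mul_neg_of_neg_of_pos h2 (Real.exp_pos (-(α * V ^ 2)))
    have h4 : 0 ≤ 2 * β * V * ∫ z in Set.Ioi V, Real.exp (-(α * z ^ 2)) := by positivity
    linarith
  · intro h
    have h2 : 0 < β / α - 1 := by rw [sub_pos, one_lt_div hα]; exact h
    set M := ∫ z : ℝ, Real.exp (-(α * z ^ 2)) with hM
    have hc : Continuous (fun V : ℝ => (β / α - 1) * Real.exp (-(α * V ^ 2))
        - 2 * β * V * M) := by fun_prop
    have hev := (hc.tendsto 0).eventually (lt_mem_nhds (a := (0:ℝ)) (by simpa using h2))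
    obtain ⟨ε, hε, H⟩ := Metric.eventually_nhds_iff.1 hev
    refine ⟨ε, hε, fun V hV hVε => ?_⟩
    have h3 := H (y := V) (by simpa [abs_of_nonneg hV] using hVε)
    have hG : ∫ z in Set.Ioi V, Real.exp (-(α * z ^ 2)) ≤ M :=
      setIntegral_le_integral i0 (Filter.Eventually.of_forall fun z => (Real.exp_pos _).le)
    have h4 := mul_le_mul_of_nonneg_left hG (by positivity : 0 ≤ 2 * β * V)
    linarith
end

section
/- Let α, β > 0 and let V > 0 satisfy V² > β/(2α²). Then 2β ∫_V^∞ (z − V) e^{−α z²} dz < e^{−α V²}; that is, the Reversal Criterion holds for every sufficiently fast equilibrium speed. In particular, when α = β the velocity reverses whenever V² > 1/(2α). -/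
open MeasureTheory Real Set

/-- for the Gaussian example, the Reversal Criterion
2β∫_V^∞ (z−V)e^{−αz²}dz < e^{−αV²} holds whenever V² > β/(2α²). -/
theorem gaussian_fast_reversal (α β V : ℝ) (hα : 0 < α) (hβ : 0 < β) (hV : 0 < V)
    (h : β / (2 * α ^ 2) < V ^ 2) :
    2 * β * (∫ z in Set.Ioi V, (z - V) * Real.exp (-(α * z ^ 2)))
      < Real.exp (-(α * V ^ 2)) := by
  obtain ⟨c, hcd⟩ : ∃ c, c = 2 * α * V := ⟨_, rfl⟩
  have hc : 0 < c := by rw [hcd]; positivity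
  obtain ⟨E, hE⟩ : ∃ E, E = Real.exp (-(α * V ^ 2)) := ⟨_, rfl⟩
  have hEpos : 0 < E := by rw [hE]; positivity
  have hder : ∀ x ∈ Set.Ici V, HasDerivAt
      (fun z : ℝ => -(E / c ^ 2) * ((c * (z - V)) ^ 1 * Real.exp (-(c * (z - V)))
        + (c * (z - V)) ^ 0 * Real.exp (-(c * (z - V)))))
      (E * ((x - V) * Real.exp (-(c * (x - V))))) x := by
    intro x _
    have h1 : HasDerivAt (fun z : ℝ => c * (z - V)) c x := by
      simpa using ((hasDerivAt_id x).sub_const V).const_mul c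
    have h2 := h1.neg.exp
    have h3 := ((h1.mul h2).add h2).const_mul (-(E / c ^ 2))
    have h4 : HasDerivAt (fun z : ℝ => -(E / c ^ 2) * (c * (z - V) * Real.exp (-(c * (z - V)))
        + Real.exp (-(c * (z - V))))) _ x := h3
    simp only [pow_one, pow_zero, one_mul]
    refine h4.congr_deriv ?_
    simp only [Pi.neg_apply]
    field_simp
    ring
  have hnn : ∀ x ∈ Set.Ioi V, 0 ≤ E * ((x - V) * Real.exp (-(c * (x - V)))) := by
    intro x hx
    have : 0 < x - V := sub_pos.2 hx
    positivity
  have hlim : Filter.Tendsto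
      (fun z : ℝ => -(E / c ^ 2) * ((c * (z - V)) ^ 1 * Real.exp (-(c * (z - V)))
        + (c * (z - V)) ^ 0 * Real.exp (-(c * (z - V))))) Filter.atTop (nhds 0) := by
    have ht : Filter.Tendsto (fun z : ℝ => c * (z - V)) Filter.atTop Filter.atTop :=
      (Filter.tendsto_atTop_add_const_right _ (-V) Filter.tendsto_id).const_mul_atTop hc
    have := (((Real.tendsto_pow_mul_exp_neg_atTop_nhds_zero 1).comp ht).add
      ((Real.tendsto_pow_mul_exp_neg_atTop_nhds_zero 0).comp ht)).const_mul (-(E / c ^ 2))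
    simpa using this
  have hint := integrableOn_Ioi_deriv_of_nonneg' hder hnn hlim
  have hval := integral_Ioi_of_hasDerivAt_of_nonneg' hder hnn hlim
  have hle : (∫ z in Set.Ioi V, (z - V) * Real.exp (-(α * z ^ 2)))
      ≤ ∫ z in Set.Ioi V, E * ((z - V) * Real.exp (-(c * (z - V)))) := by
    refine integral_mono_of_nonneg ?_ hint ?_
    · filter_upwards [ae_restrict_mem measurableSet_Ioi] with x hx
      have : 0 < x - V := sub_pos.2 hx
      simp only [Pi.zero_apply]
      positivity
    · filter_upwards [ae_restrict_mem measurableSet_Ioi] with x hx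
      have hx0 : 0 < x - V := sub_pos.2 hx
      have : Real.exp (-(α * x ^ 2)) ≤ E * Real.exp (-(c * (x - V))) := by
        rw [hE, ← Real.exp_add, Real.exp_le_exp, hcd]
        nlinarith [mul_nonneg hα.le (sq_nonneg (x - V))]
      calc (x - V) * Real.exp (-(α * x ^ 2)) ≤ (x - V) * (E * Real.exp (-(c * (x - V)))) :=
            mul_le_mul_of_nonneg_left this hx0.le
        _ = _ := by ring
  rw [hval] at hle
  simp only [sub_self, mul_zero, pow_one, pow_zero, neg_zero, Real.exp_zero, one_mul, zero_mul,
    zero_add, mul_one, sub_neg_eq_add] at hle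
  rw [← hE]
  have hk : 2 * β < c ^ 2 := by
    rw [div_lt_iff₀ (by positivity)] at h
    rw [hcd]
    nlinarith
  calc _ ≤ 2 * β * (E / c ^ 2) := mul_le_mul_of_nonneg_left hle (by positivity)
    _ < c ^ 2 * (E / c ^ 2) := mul_lt_mul_of_pos_right hk (by positivity)
    _ = E := by field_simp
end

section
/- Let α, β > 0 and let V > 0 satisfy 1/(4α²V²) − 3/(8α³V⁴) > 1/(2β). Then 2β ∫_V^∞ (z − V) e^{−α z²} dz > e^{−α V²}; that is, the Irreversal Criterion holds. In particular such V exist whenever β > 12α. -/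
open MeasureTheory Real Set

theorem gfi_bound (α : ℝ) (hα : 0 < α) (V : ℝ) (hV : 0 < V) :
    Real.exp (-(α * V ^ 2)) * (1 / (4 * α ^ 2 * V ^ 2) - 3 / (8 * α ^ 3 * V ^ 4))
      ≤ ∫ z in Set.Ioi V, (z - V) * Real.exp (-(α * z ^ 2)) := by
  have hE : ∀ z : ℝ, HasDerivAt (fun z => Real.exp (-(α * z ^ 2)))
      (-(2 * α * z) * Real.exp (-(α * z ^ 2))) z := by
    intro z
    have h := (((hasDerivAt_pow 2 z).const_mul α).neg).exp
    refine HasDerivAt.congr_deriv h ?_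
    simp only [Pi.neg_apply]
    push_cast
    ring
  have hlim : Filter.Tendsto (fun z : ℝ => Real.exp (-(α * z ^ 2))) Filter.atTop (nhds 0) := by
    apply Real.tendsto_exp_neg_atTop_nhds_zero.comp
    exact (Filter.tendsto_pow_atTop (by norm_num)).const_mul_atTop hα
  have hF : ∀ z : ℝ, HasDerivAt (fun z => -(1 / (2 * α)) * Real.exp (-(α * z ^ 2)))
      (z * Real.exp (-(α * z ^ 2))) z := by
    intro z
    refine HasDerivAt.congr_deriv ((hE z).const_mul (-(1 / (2 * α)))) ?_
    field_simp
  have hFlim : Filter.Tendsto (fun z : ℝ => -(1 / (2 * α)) * Real.exp (-(α * z ^ 2)))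
      Filter.atTop (nhds 0) := by
    simpa using hlim.const_mul (-(1 / (2 * α)))
  have hH : ∀ z : ℝ, 0 < z → HasDerivAt
      (fun z => Real.exp (-(α * z ^ 2)) *
        (1 / (2 * α) * z⁻¹ - 1 / (4 * α ^ 2) * (z⁻¹) ^ 3 + 3 / (8 * α ^ 3) * (z⁻¹) ^ 5))
      (-(Real.exp (-(α * z ^ 2)) * (1 + 15 / (8 * α ^ 3) * (z⁻¹) ^ 6))) z := by
    intro z hz
    have hi := hasDerivAt_inv hz.ne'
    have h := (hE z).mul (((hi.const_mul (1 / (2 * α))).sub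
      ((hi.pow 3).const_mul (1 / (4 * α ^ 2)))).add ((hi.pow 5).const_mul (3 / (8 * α ^ 3))))
    refine HasDerivAt.congr_deriv h ?_
    simp only [Pi.add_apply, Pi.sub_apply, Pi.pow_apply, Pi.inv_apply]
    push_cast
    field_simp
    ring
  have hHlim : Filter.Tendsto (fun z : ℝ => Real.exp (-(α * z ^ 2)) *
        (1 / (2 * α) * z⁻¹ - 1 / (4 * α ^ 2) * (z⁻¹) ^ 3 + 3 / (8 * α ^ 3) * (z⁻¹) ^ 5))
      Filter.atTop (nhds 0) := by
    have hi : Filter.Tendsto (fun z : ℝ => z⁻¹) Filter.atTop (nhds 0) := tendsto_inv_atTop_zero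
    have h := hlim.mul (((hi.const_mul (1 / (2 * α))).sub
      ((hi.pow 3).const_mul (1 / (4 * α ^ 2)))).add ((hi.pow 5).const_mul (3 / (8 * α ^ 3))))
    simpa using h
  have pos : ∀ z ∈ Ici V, 0 < z := fun z hz => lt_of_lt_of_le hV hz
  have pos' : ∀ z ∈ Ioi V, 0 < z := fun z hz => lt_trans hV hz
  have iF : IntegrableOn (fun z : ℝ => z * Real.exp (-(α * z ^ 2))) (Ioi V) :=
    integrableOn_Ioi_deriv_of_nonneg' (fun z _ => hF z)
      (fun z hz => by have := pos' z hz; positivity) hFlim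
  have iH : IntegrableOn (fun z : ℝ => -(Real.exp (-(α * z ^ 2)) *
      (1 + 15 / (8 * α ^ 3) * (z⁻¹) ^ 6))) (Ioi V) :=
    integrableOn_Ioi_deriv_of_nonpos' (fun z hz => hH z (pos z hz))
      (fun z hz => by have := pos' z hz; rw [neg_nonpos]; positivity) hHlim
  have eF := integral_Ioi_of_hasDerivAt_of_tendsto' (fun z _ => hF z) iF hFlim
  have eH := integral_Ioi_of_hasDerivAt_of_tendsto' (fun z hz => hH z (pos z hz)) iH hHlim
  have iE : IntegrableOn (fun z : ℝ => Real.exp (-(α * z ^ 2))) (Ioi V) := by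
    have := (integrable_exp_neg_mul_sq hα).integrableOn (s := Ioi V)
    simpa [neg_mul] using this
  have if' : IntegrableOn (fun z : ℝ => (z - V) * Real.exp (-(α * z ^ 2))) (Ioi V) := by
    have := iF.sub (iE.const_mul V)
    refine this.congr (Filter.Eventually.of_forall fun z => ?_)
    simp; ring
  have hle := setIntegral_mono_on (iF.add (iH.const_mul V)) if' measurableSet_Ioi
    (fun z hz => by
      have := pos' z hz
      have h2 : 0 ≤ V * (Real.exp (-(α * z ^ 2)) * (15 / (8 * α ^ 3) * (z⁻¹) ^ 6)) := by
        positivity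
      simp only [Pi.add_apply]
      nlinarith [h2])
  have hs := integral_add' iF (iH.const_mul V)
  rw [hs, integral_const_mul, eF, eH] at hle
  refine le_trans (le_of_eq ?_) hle
  field_simp
  ring

/-- for the Gaussian example, the Irreversal Criterion
2β∫_V^∞ (z−V)e^{−αz²}dz > e^{−αV²} holds whenever 1/(4α²V²) − 3/(8α³V⁴) > 1/(2β);
in particular such V > 0 exist whenever β > 12α. -/
theorem gaussian_fast_irreversal (α β : ℝ) (hα : 0 < α) (hβ : 0 < β) :
    (∀ V : ℝ, 0 < V →
      1 / (2 * β) < 1 / (4 * α ^ 2 * V ^ 2) - 3 / (8 * α ^ 3 * V ^ 4) →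
      Real.exp (-(α * V ^ 2))
        < 2 * β * ∫ z in Set.Ioi V, (z - V) * Real.exp (-(α * z ^ 2))) ∧
    (12 * α < β → ∃ V > (0:ℝ),
      1 / (2 * β) < 1 / (4 * α ^ 2 * V ^ 2) - 3 / (8 * α ^ 3 * V ^ 4)) := by
  constructor
  · intro V hV h
    have hb := gfi_bound α hα V hV
    have he := Real.exp_pos (-(α * V ^ 2))
    have h1 := lt_of_lt_of_le (mul_lt_mul_of_pos_left h he) hb
    have h2 := mul_lt_mul_of_pos_left h1 (by positivity : 0 < 2 * β)
    refine lt_of_eq_of_lt ?_ h2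
    field_simp
  · intro h
    refine ⟨Real.sqrt (3 / α), by positivity, ?_⟩
    have h2 : Real.sqrt (3 / α) ^ 2 = 3 / α := Real.sq_sqrt (by positivity)
    have h4 : Real.sqrt (3 / α) ^ 4 = (3 / α) ^ 2 := by
      rw [show Real.sqrt (3 / α) ^ 4 = (Real.sqrt (3 / α) ^ 2) ^ 2 by ring, h2]
    rw [h4, h2]
    have : 1 / (4 * α ^ 2 * (3 / α)) - 3 / (8 * α ^ 3 * (3 / α) ^ 2) = 1 / (24 * α) := by
      field_simp
      norm_num
    rw [this]
    apply one_div_lt_one_div_of_lt <;> linarith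
end

section
/- Let β > 0 and let V > 0 satisfy 1/(βV) − 1/(2β²V³) > 1. Then (2/√β) ∫_{√β V}^∞ e^{−z²} dz > e^{−β V²}; that is, the Gaussian initial density a₀(u) = C₁ e^{−β u²} satisfies the Irreversal Criterion for the kernel k(v,u) = 2 e^{−v²/|u|} at equilibrium speed V. -/
open MeasureTheory Real Set

lemma tail_lower (x : ℝ) (hx : 0 < x) :
    Real.exp (-(x ^ 2)) * (1 / (2 * x) - 1 / (4 * x ^ 3))
      ≤ ∫ z in Set.Ioi x, Real.exp (-(z ^ 2)) := by
  have hint : IntegrableOn (fun z : ℝ => Real.exp (-(z ^ 2))) (Set.Ioi x) := by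
    have := (integrable_exp_neg_mul_sq (b := 1) one_pos)
    simpa using this.integrableOn (s := Set.Ioi x)
  have hder : ∀ z ∈ Set.Ici x, HasDerivAt
      (fun z : ℝ => -(Real.exp (-(z ^ 2)) * (1 / (2 * z) - 1 / (4 * z ^ 3))))
      (Real.exp (-(z ^ 2)) * (1 - 3 / (4 * z ^ 4))) z := by
    intro z hz
    have hz0 : z ≠ 0 := (lt_of_lt_of_le hx hz).ne'
    have h1 : HasDerivAt (fun z : ℝ => Real.exp (-(z ^ 2))) _ z :=
      ((hasDerivAt_pow 2 z).fun_neg).exp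
    have h2 : HasDerivAt (fun z : ℝ => 1 / (2 * z)) _ z :=
      (hasDerivAt_const z (1 : ℝ)).fun_div ((hasDerivAt_id' z).const_mul 2) (by positivity)
    have h3 : HasDerivAt (fun z : ℝ => 1 / (4 * z ^ 3)) _ z :=
      (hasDerivAt_const z (1 : ℝ)).fun_div ((hasDerivAt_pow 3 z).const_mul 4) (by positivity)
    refine (h1.fun_mul (h2.fun_sub h3)).fun_neg.congr_deriv ?_
    field_simp
    norm_num
    ring
  have hint' : IntegrableOn (fun z : ℝ => Real.exp (-(z ^ 2)) * (1 - 3 / (4 * z ^ 4)))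
      (Set.Ioi x) := by
    refine Integrable.mono' (hint.mul_const (1 + 3 / (4 * x ^ 4))) ?_ ?_
    · exact (by fun_prop : Measurable _).aestronglyMeasurable
    · refine (ae_restrict_iff' measurableSet_Ioi).2 (Filter.Eventually.of_forall ?_)
      intro z hz
      have hz' : x < z := hz
      have hz0 : 0 < z := hx.trans hz'
      rw [norm_mul, Real.norm_eq_abs, Real.norm_eq_abs, abs_of_pos (Real.exp_pos _)]
      gcongr
      have h1 : 3 / (4 * z ^ 4) ≤ 3 / (4 * x ^ 4) := by gcongr
      have h2 : 0 < 3 / (4 * z ^ 4) := by positivity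
      rw [abs_le]
      constructor <;> linarith
  have hlim : Filter.Tendsto
      (fun z : ℝ => -(Real.exp (-(z ^ 2)) * (1 / (2 * z) - 1 / (4 * z ^ 3))))
      Filter.atTop (nhds 0) := by
    have h1 : Filter.Tendsto (fun z : ℝ => Real.exp (-(z ^ 2))) Filter.atTop (nhds 0) :=
      Real.tendsto_exp_neg_atTop_nhds_zero.comp (Filter.tendsto_pow_atTop two_ne_zero)
    have h2 : Filter.Tendsto (fun z : ℝ => 1 / (2 * z)) Filter.atTop (nhds 0) :=
      Filter.Tendsto.const_div_atTop (Filter.tendsto_id.const_mul_atTop two_pos) 1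
    have h3 : Filter.Tendsto (fun z : ℝ => 1 / (4 * z ^ 3)) Filter.atTop (nhds 0) :=
      Filter.Tendsto.const_div_atTop
        ((Filter.tendsto_pow_atTop three_ne_zero).const_mul_atTop four_pos) 1
    simpa using (h1.mul (h2.sub h3)).neg
  have key := integral_Ioi_of_hasDerivAt_of_tendsto' hder hint' hlim
  have : Real.exp (-(x ^ 2)) * (1 / (2 * x) - 1 / (4 * x ^ 3))
      = ∫ z in Set.Ioi x, Real.exp (-(z ^ 2)) * (1 - 3 / (4 * z ^ 4)) := by
    rw [key]; ring
  rw [this]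
  refine setIntegral_mono_on hint' hint measurableSet_Ioi ?_
  intro z hz
  have h2 : 0 ≤ 3 / (4 * z ^ 4) := by positivity
  have h3 := Real.exp_pos (-(z ^ 2))
  nlinarith [mul_nonneg h3.le h2]



open MeasureTheory Real Set

/-- the Gaussian density a₀(u) = C₁e^{−βu²} satisfies the Irreversal
Criterion (2/√β)∫_{√β V}^∞ e^{−z²} dz > e^{−βV²} whenever 1/(βV) − 1/(2β²V³) > 1. -/
theorem gaussian_irreversal_tail (β V : ℝ) (hβ : 0 < β) (hV : 0 < V)
    (h : 1 < 1 / (β * V) - 1 / (2 * β ^ 2 * V ^ 3)) :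
    Real.exp (-(β * V ^ 2))
      < (2 / Real.sqrt β) * ∫ z in Set.Ioi (Real.sqrt β * V), Real.exp (-(z ^ 2)) := by
  have hs : 0 < Real.sqrt β := Real.sqrt_pos.2 hβ
  have hss : Real.sqrt β ^ 2 = β := Real.sq_sqrt hβ.le
  have ht := tail_lower (Real.sqrt β * V) (by positivity)
  generalize Real.sqrt β = s at *
  subst hss
  refine lt_of_lt_of_le ?_ (mul_le_mul_of_nonneg_left ht (by positivity))
  have e : 2 / s * (Real.exp (-((s * V) ^ 2)) * (1 / (2 * (s * V)) - 1 / (4 * (s * V) ^ 3)))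
      = Real.exp (-(s ^ 2 * V ^ 2)) * (1 / (s ^ 2 * V) - 1 / (2 * (s ^ 2) ^ 2 * V ^ 3)) := by
    rw [mul_pow s V 2]
    field_simp
    ring
  rw [e]
  exact lt_mul_of_one_lt_right (Real.exp_pos _) h
end
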